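/- Let (R,𝔪) be a commutative Noetherian local ring, 𝔞 an ideal of R, and M a nonzero finitely generated R-module with 𝔞M ≠ M. If grade(𝔞,M) < depth M, then grade(𝔞,M) = inf{ i ∈ ℕ : H^i_𝔞(M) is not Artinian }; that is, H^i_𝔞(M) is Artinian for all i < grade(𝔞,M) and H^{grade(𝔞,M)}_𝔞(M) is not Artinian. -/

import Mathlib

/-!
STATEMENT 3: Let (R,𝔪) be a commutative Noetherian local ring, 𝔞 an ideal of R, and M a
nonzero finitely generated R-module with 𝔞M ≠ M. If grade(𝔞,M) < depth M, then
grade(𝔞,M) = inf{ i : H^i_𝔞(M) is not Artinian }; that is, H^i_𝔞(M) is Artinian for all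
i < grade(𝔞,M) and H^{grade(𝔞,M)}_𝔞(M) is not Artinian.

We encode `r = grade(𝔞,M)` by: `Ext^r_R(R/𝔞,M)` is nontrivial and `Ext^i_R(R/𝔞,M)` is trivial
for `i < r`; and `grade(𝔞,M) < depth M` by: `Ext^i_R(R/𝔪,M)` is trivial for all `i ≤ r`.
-/

open CategoryTheory Opposite

universe u v

namespace CategoryTheory.ProjectiveResolution

variable {R : Type u} [CommRing R] {C : Type v} [Category.{u} C] [Abelian C] [Linear R C]
  {X X' Y : C} {n : ℕ}

lemma extMk_eq_zero_iff_of_zero [HasExt.{u} C] (P : ProjectiveResolution X)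
    (f : P.complex.X 0 ⟶ Y) (hf : P.complex.d 1 0 ≫ f = 0) :
    P.extMk f 1 rfl hf = 0 ↔ f = 0 := by
  refine ⟨fun h => ?_, ?_⟩
  · simp only [← P.extEquivCohomologyClass.apply_eq_iff_eq,
    extEquivCohomologyClass_extMk, extEquivCohomologyClass_zero,
    CochainComplex.HomComplex.CohomologyClass.mk_eq_zero_iff] at h
    rw [CochainComplex.HomComplex.Cocycle.toSingleMk_mem_coboundaries_iff _ _ _ _ _ 1
      (by lia)] at h
    obtain ⟨g, hg⟩ := h
    have : g = 0 :=
      Limits.IsZero.eq_of_src (P.cochainComplex.isZero_of_isStrictlyLE 0 1 (by lia)) _ _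
    rw [this, Limits.comp_zero] at hg
    rw [← cancel_epi (P.cochainComplexXIso (-(0 : ℕ)) 0 rfl).hom, ← hg, Limits.comp_zero]
  · rintro rfl
    simp

lemma smul_extMk [HasExt.{u} C] (P : ProjectiveResolution X) (r : R) (f : P.complex.X n ⟶ Y)
    (hf : P.complex.d (n + 1) n ≫ f = 0) :
    r • P.extMk f (n + 1) rfl hf = P.extMk (r • f) (n + 1) rfl (by simp [hf]) := by
  rw [Abelian.Ext.smul_eq_comp_mk₀, extMk_comp_mk₀]
  simp

variable [EnoughProjectives C]

/-- The map of complexes `Hom(L, Y) ⟶ Hom(K, Y)` induced by a chain map `K ⟶ L`. -/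
noncomputable def linearYonedaMap (R : Type u) [CommRing R] [Linear R C]
    {K L : ChainComplex C ℕ} (f : K ⟶ L) (Y : C) :
    L.linearYonedaObj R Y ⟶ K.linearYonedaObj R Y :=
  (HomologicalComplex.unopFunctor _ _).map
    ((((linearYoneda R C).obj Y).rightOp.mapHomologicalComplex _).map f).op

lemma isoExt_hom_naturality {P : ProjectiveResolution X} {Q : ProjectiveResolution X'}
    {g : X' ⟶ X} (φ : Hom Q P g) :
    ((Ext R C n).map g.op).app Y ≫ (Q.isoExt n Y).hom =
      (P.isoExt n Y).hom ≫ HomologicalComplex.homologyMap (linearYonedaMap R φ.hom Y) n := by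
  have h1 : ((Ext R C n).map g.op).app Y ≫
      (Q.isoLeftDerivedObj ((linearYoneda R C).obj Y).rightOp n).inv.unop = _ :=
    congrArg Quiver.Hom.unop (isoLeftDerivedObj_inv_naturality g Q P φ.hom
      (by simpa using φ.hom_f_zero_comp_π_f_zero) ((linearYoneda R C).obj Y).rightOp n)
  have h2 := congrArg Quiver.Hom.unop (ShortComplex.homologyOpIso_inv_naturality
    ((HomologicalComplex.shortComplexFunctor _ (ComplexShape.up ℕ) n).map
      (linearYonedaMap R φ.hom Y)))
  refine (congrArg (· ≫ (HomologicalComplex.homologyOp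
    (Q.complex.linearYonedaObj R Y) n).inv.unop) h1).trans ?_
  exact congrArg ((P.isoLeftDerivedObj ((linearYoneda R C).obj Y).rightOp n).inv.unop ≫ ·) h2.symm

/-- The cochain `f : Pₙ ⟶ Y` is a cocycle whose class is `e`, viewed as an element of the
`n`-th cohomology of `Hom(P, Y)`. -/
def Represents (P : ProjectiveResolution X) (f : P.complex.X n ⟶ Y)
    (e : ((Ext R C n).obj (op X)).obj Y) : Prop :=
  ∃ z : (P.complex.linearYonedaObj R Y).cycles n,
    (P.complex.linearYonedaObj R Y).iCycles n z = f ∧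
    (P.complex.linearYonedaObj R Y).homologyπ n z = (P.isoExt n Y).hom e

variable {P : ProjectiveResolution X}

lemma exists_represents (P : ProjectiveResolution X) (e : ((Ext R C n).obj (op X)).obj Y) :
    ∃ f, P.Represents f e := by
  obtain ⟨z, hz⟩ := (ModuleCat.epi_iff_surjective
    ((P.complex.linearYonedaObj R Y).homologyπ n)).mp inferInstance ((P.isoExt n Y).hom e)
  exact ⟨_, z, rfl, hz⟩

lemma Represents.d_comp {f : P.complex.X n ⟶ Y} {e : ((Ext R C n).obj (op X)).obj Y}
    (h : P.Represents f e) : P.complex.d (n + 1) n ≫ f = 0 := by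
  obtain ⟨z, rfl, -⟩ := h
  exact congr($((P.complex.linearYonedaObj R Y).iCycles_d n (n + 1)) z)

lemma exists_represents_of_d_comp (R : Type u) [CommRing R] [Linear R C]
    {f : P.complex.X n ⟶ Y}
    (h : P.complex.d (n + 1) n ≫ f = 0) :
    ∃ e : ((Ext R C n).obj (op X)).obj Y, P.Represents f e := by
  let K := P.complex.linearYonedaObj R Y
  let k : ModuleCat.of R R ⟶ K.X n := ModuleCat.ofHom (LinearMap.toSpanSingleton R _ f)
  have hk : k ≫ K.d n (n + 1) = 0 := by
    ext
    change P.complex.d (n + 1) n ≫ ((1 : R) • f) = 0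
    rw [one_smul, h]
  refine ⟨(P.isoExt n Y).inv (K.homologyπ n (K.liftCycles k (n + 1) (by simp) hk (1 : R))),
    K.liftCycles k (n + 1) (by simp) hk (1 : R), ?_, ?_⟩
  · refine (congr($(K.liftCycles_i k (n + 1) (by simp) hk) (1 : R))).trans ?_
    exact one_smul R f
  · exact (congr($((P.isoExt n Y).inv_hom_id) _)).symm

lemma Represents.smul {f : P.complex.X n ⟶ Y} {e : ((Ext R C n).obj (op X)).obj Y}
    (h : P.Represents f e) (r : R) : P.Represents (r • f) (r • e) := by
  obtain ⟨z, rfl, h⟩ := h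
  exact ⟨r • z, map_smul _ _ _, by rw [map_smul, h, map_smul]⟩

lemma Represents.map {f : P.complex.X n ⟶ Y} {e : ((Ext R C n).obj (op X)).obj Y}
    (h : P.Represents f e) {Q : ProjectiveResolution X'} {g : X' ⟶ X} (φ : Hom Q P g) :
    Q.Represents (φ.hom.f n ≫ f) (((Ext R C n).map g.op).app Y e) := by
  obtain ⟨z, rfl, h⟩ := h
  refine ⟨HomologicalComplex.cyclesMap (linearYonedaMap R φ.hom Y) n z, ?_, ?_⟩
  · exact congr($(HomologicalComplex.cyclesMap_i (linearYonedaMap R φ.hom Y) n) z)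
  · refine (congr($(HomologicalComplex.homologyπ_naturality
      (linearYonedaMap R φ.hom Y) n) z)).symm.trans ?_
    refine (congrArg (HomologicalComplex.homologyMap (linearYonedaMap R φ.hom Y) n) h).trans ?_
    exact (congr($(isoExt_hom_naturality (R := R) φ) e)).symm

lemma Represents.eq_zero_iff [HasExt.{u} C] {f : P.complex.X n ⟶ Y}
    {e : ((Ext R C n).obj (op X)).obj Y} (h : P.Represents f e) :
    e = 0 ↔ P.extMk f (n + 1) rfl h.d_comp = 0 := by
  have key : e = 0 ↔ ∃ w : (P.complex.linearYonedaObj R Y).X ((ComplexShape.up ℕ).prev n),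
      (P.complex.linearYonedaObj R Y).d _ n w = f := by
    obtain ⟨z, hz, h⟩ := h
    have h1 : e = 0 ↔ (P.complex.linearYonedaObj R Y).homologyπ n z = 0 := by
      rw [h]
      exact (P.isoExt n Y).toLinearEquiv.map_eq_zero_iff.symm
    let S := (P.complex.linearYonedaObj R Y).sc n
    have hmono := (ModuleCat.mono_iff_injective S.iCycles).mp inferInstance
    have hex : Function.Exact S.toCycles S.homologyπ :=
      (ShortComplex.ShortExact.moduleCat_exact_iff_function_exact _).mp
        (ShortComplex.exact_of_g_is_cokernel (.mk _ _ S.toCycles_comp_homologyπ)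
          S.homologyIsCokernel)
    refine h1.trans ((hex z).trans ⟨fun ⟨w, hw⟩ ↦ ⟨w, ?_⟩, fun ⟨w, hw⟩ ↦ ⟨w, hmono ?_⟩⟩)
    · rw [← hz, ← hw]
      exact (congr($(S.toCycles_i) w)).symm
    · refine (congr($(S.toCycles_i) w)).trans ?_
      exact hw.trans hz.symm
  rw [key]
  cases n with
  | zero =>
    rw [extMk_eq_zero_iff_of_zero]
    have : (P.complex.linearYonedaObj R Y).d ((ComplexShape.up ℕ).prev 0) 0 = 0 :=
      HomologicalComplex.shape _ _ _ (by simp)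
    simp only [this]
    exact ⟨fun ⟨_, h⟩ ↦ h.symm, fun h ↦ ⟨0, h.symm⟩⟩
  | succ n =>
    rw [extMk_eq_zero_iff _ _ _ _ _ n rfl, CochainComplex.prev_nat_succ]
    rfl

end CategoryTheory.ProjectiveResolution

section Comparison

variable {R : Type u} [CommRing R] {C : Type v} [Category.{u} C] [Abelian C] [Linear R C]
  [EnoughProjectives C] [HasExt.{u} C] {X X' Y : C} {n : ℕ}

lemma subsingleton_ext_obj_iff :
    Subsingleton (((Ext R C n).obj (op X)).obj Y) ↔ Subsingleton (Abelian.Ext X Y n) := by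
  let P := projectiveResolution X
  refine ⟨fun h ↦ subsingleton_of_forall_eq 0 fun x ↦ ?_,
    fun h ↦ subsingleton_of_forall_eq 0 fun e ↦ ?_⟩
  · obtain ⟨f, hf, rfl⟩ := P.extMk_surjective x (n + 1) rfl
    obtain ⟨e, he⟩ := P.exists_represents_of_d_comp R hf
    exact he.eq_zero_iff.mp (Subsingleton.elim _ _)
  · obtain ⟨f, hf⟩ := P.exists_represents e
    exact hf.eq_zero_iff.mpr (Subsingleton.elim _ _)

lemma injective_ext_map_app {g : X' ⟶ X}
    (hg : ∀ x : Abelian.Ext X Y n, (Abelian.Ext.mk₀ g).comp x (zero_add n) = 0 → x = 0) :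
    Function.Injective (((Ext R C n).map g.op).app Y) := by
  let P := projectiveResolution X
  let Q := projectiveResolution X'
  let φ : ProjectiveResolution.Hom Q P g := ⟨ProjectiveResolution.lift g Q P,
    (congr(($(ProjectiveResolution.lift_commutes g Q P)).f 0)).trans (by simp)⟩
  refine (injective_iff_map_eq_zero _).mpr fun e he ↦ ?_
  obtain ⟨f, hf⟩ := P.exists_represents e
  rw [hf.eq_zero_iff]
  apply hg
  rw [ProjectiveResolution.mk₀_comp_extMk _ _ _ _ φ]
  exact (hf.map φ).eq_zero_iff.mp he

lemma ext_obj_eq_zero_of_smul_eq_zero {J : Ideal R}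
    (h : ∀ x : Abelian.Ext X Y n, (∀ r ∈ J, r • x = 0) → x = 0)
    (e : ((Ext R C n).obj (op X)).obj Y) (he : ∀ r ∈ J, r • e = 0) : e = 0 := by
  obtain ⟨f, hf⟩ := (projectiveResolution X).exists_represents e
  rw [hf.eq_zero_iff]
  refine h _ fun r hr ↦ ?_
  rw [ProjectiveResolution.smul_extMk]
  exact (hf.smul r).eq_zero_iff.mp (he r hr)

end Comparison

section Regular

open Abelian

variable {R : Type u} [CommRing R]

lemma IsSMulRegular.subsingleton_ext_quotSMulTop {M : ModuleCat.{u} R} {a : R}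
    (ha : IsSMulRegular M a) (N : ModuleCat.{u} R) {i : ℕ}
    (h₁ : Subsingleton (Abelian.Ext N M i)) (h₂ : Subsingleton (Abelian.Ext N M (i + 1))) :
    Subsingleton (Abelian.Ext N (ModuleCat.of R (QuotSMulTop a M)) i) := by
  refine subsingleton_of_forall_eq 0 fun x ↦ ?_
  obtain ⟨y, hy⟩ := Abelian.Ext.covariant_sequence_exact₃ N ha.smulShortComplex_shortExact x rfl
    (h₂.elim _ _)
  rw [← hy, h₁.elim y 0]
  exact Abelian.Ext.zero_comp ..

lemma RingTheory.Sequence.IsWeaklyRegular.ext_eq_zero_of_smul_eq_zero {J : Ideal R}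
    {N : ModuleCat.{u} R} {M : ModuleCat.{u} R} {rs : List R} (reg : IsWeaklyRegular M rs)
    (hrs : ∀ a ∈ rs, a ∈ Module.annihilator R N)
    (hN : ∀ i < rs.length, Subsingleton (Abelian.Ext N M i))
    (hJ : ∀ i ≤ rs.length, Subsingleton (Abelian.Ext (ModuleCat.of R (R ⧸ J)) M i))
    (x : Abelian.Ext N M rs.length) (hx : ∀ b ∈ J, b • x = 0) : x = 0 := by
  induction rs generalizing M with
  | nil =>
    have h0 : Subsingleton (ModuleCat.of R (R ⧸ J) ⟶ M) :=
      Abelian.Ext.addEquiv₀.subsingleton_congr.mp (hJ 0 le_rfl)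
    obtain ⟨φ, rfl⟩ := (Abelian.Ext.linearEquiv₀ (R := R) (X := N) (Y := M)).symm.surjective x
    have hφ (b : R) (hb : b ∈ J) : b • φ = 0 := by
      have := hx b hb
      rwa [← map_smul, LinearEquiv.map_eq_zero_iff] at this
    suffices φ = 0 by rw [this, map_zero]
    ext y
    let ψ : (R ⧸ J) →ₗ[R] M := Submodule.liftQ J (LinearMap.toSpanSingleton R M (φ y))
      fun b hb ↦ congr($(hφ b hb) y)
    have hψ : ModuleCat.ofHom ψ = 0 := Subsingleton.elim _ _
    have h1 : ψ (Submodule.Quotient.mk 1) = φ y := one_smul R _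
    exact h1.symm.trans congr($hψ (Submodule.Quotient.mk 1))
  | cons a rs ih =>
    rw [isWeaklyRegular_cons_iff] at reg
    obtain ⟨ha, reg⟩ := reg
    simp only [List.mem_cons, forall_eq_or_imp] at hrs
    have hS := ha.smulShortComplex_shortExact
    obtain ⟨y, rfl⟩ := Abelian.Ext.covariant_sequence_exact₁ N hS x
      (congr($(Abelian.Ext.postcomp_smul_id_eq_zero_of_mem_annihilator hrs.1 _) x))
      (n₀ := rs.length) rfl
    have hy : y = 0 := by
      refine ih (M := ModuleCat.of R (QuotSMulTop a M)) reg hrs.2 (fun i hi ↦ ?_) (fun i hi ↦ ?_)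
        y (fun b hb ↦ ?_)
      · exact ha.subsingleton_ext_quotSMulTop N (hN i (by simp; omega)) (hN (i + 1) (by simpa))
      · exact ha.subsingleton_ext_quotSMulTop _ (hJ i (by simp; omega)) (hJ (i + 1) (by simpa))
      · obtain ⟨z, hz⟩ := Abelian.Ext.covariant_sequence_exact₃ N hS (b • y) rfl
          (by rw [Abelian.Ext.smul_comp]; exact hx b hb)
        refine hz.symm.trans ?_
        rw [(hN rs.length (by simp)).elim z 0]
        exact Abelian.Ext.zero_comp ..
    exact congr(($hy).comp hS.extClass rfl).trans (Abelian.Ext.zero_comp ..)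

end Regular

section LocalCohomology

variable {R : Type u} [CommRing R]

lemma IsLocalRing.exists_ne_zero_forall_smul_eq_zero [IsLocalRing R] (E : Type*) [AddCommGroup E]
    [Module R E] [IsArtinian R E] [Nontrivial E] :
    ∃ e : E, e ≠ 0 ∧ ∀ b ∈ IsLocalRing.maximalIdeal R, b • e = 0 := by
  have : IsAtomic (Submodule R E) := isAtomic_of_orderBot_wellFounded_lt wellFounded_lt
  obtain ⟨S, hS, -⟩ := (IsAtomic.eq_bot_or_exists_atom_le (⊤ : Submodule R E)).resolve_left
    top_ne_bot
  have hsimple : IsSimpleModule R S := isSimpleModule_iff_isAtom.mpr hS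
  obtain ⟨e, he, hne⟩ := S.exists_mem_ne_zero_of_ne_bot hS.1
  refine ⟨e, hne, fun b hb ↦ ?_⟩
  rw [← IsLocalRing.eq_maximalIdeal (IsSimpleModule.annihilator_isMaximal (R := R) (M := S)),
    Module.mem_annihilator] at hb
  exact congr(($(hb ⟨e, he⟩)).1)

lemma CategoryTheory.ShortComplex.ShortExact.injective_precomp_mk₀_g {C : Type v} [Category.{u} C]
    [Abelian C] [HasExt.{u} C] {S : ShortComplex C} (hS : S.ShortExact) {Y : C} {n : ℕ}
    (h : ∀ i < n, Subsingleton (Abelian.Ext S.X₁ Y i)) (x : Abelian.Ext S.X₃ Y n)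
    (hx : (Abelian.Ext.mk₀ S.g).comp x (zero_add n) = 0) : x = 0 := by
  cases n with
  | zero =>
    have := hS.epi_g
    exact (injective_iff_map_eq_zero _).mp (Abelian.Ext.precomp_mk₀_injective_of_epi Y S.g) x hx
  | succ n =>
    obtain ⟨y, rfl⟩ := Abelian.Ext.contravariant_sequence_exact₃ hS Y x hx (add_comm 1 n)
    rw [(h n (by simp)).elim y 0, Abelian.Ext.comp_zero]

lemma Ideal.support_quotient_pow_subset (I : Ideal R) (n : ℕ) :
    Module.support R (R ⧸ I ^ n) ⊆ PrimeSpectrum.zeroLocus I := by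
  rw [Module.support_eq_zeroLocus, Ideal.annihilator_quotient]
  exact fun p hp ↦ p.2.le_of_pow_le hp

namespace localCohomology

open Limits

variable (I : Ideal R) (i : ℕ) (M : ModuleCat.{u} R)

/-- The cocone exhibiting `H^i_I(M)` as the colimit of the modules `Ext^i(R/I^n, M)`. -/
noncomputable def cocone :
    Cocone (diagram (idealPowersDiagram I) i ⋙ (evaluation _ _).obj M) :=
  ((evaluation _ _).obj M).mapCocone (colimit.cocone (diagram (idealPowersDiagram I) i))

/-- The cocone `localCohomology.cocone` is a colimit. -/
noncomputable def isColimitCocone : IsColimit (cocone I i M) :=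
  isColimitOfPreserves _ (colimit.isColimit _)

variable {I i M}

instance : PreservesFilteredColimitsOfSize.{0, 0} (forget (ModuleCat.{u} R)) :=
  preservesFilteredColimitsOfSize_shrink.{0, u, 0, u} _

lemma subsingleton_of_forall
    (h : ∀ n, Subsingleton
      (((Ext R (ModuleCat.{u} R) i).obj (op (ModuleCat.of R (R ⧸ I ^ n)))).obj M)) :
    Subsingleton ((localCohomology I i).obj M) := by
  refine subsingleton_of_forall_eq 0 fun x ↦ ?_
  obtain ⟨j, y, rfl⟩ := Concrete.isColimit_exists_rep _ (isColimitCocone I i M) x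
  exact (congrArg _ ((h j.unop.unop).elim y 0)).trans (map_zero _)

lemma injective_ι_app
    (h : ∀ (m n : ℕ) (hmn : I ^ m ≤ I ^ n), Function.Injective (((Ext R (ModuleCat.{u} R) i).map
      (ModuleCat.ofHom (Submodule.mapQ _ _ LinearMap.id hmn : R ⧸ I ^ m →ₗ[R] R ⧸ I ^ n)).op).app
        M)) (j : ℕᵒᵖᵒᵖ) :
    Function.Injective ((cocone I i M).ι.app j) := by
  intro x y hxy
  obtain ⟨k, f, g, hfg⟩ := Concrete.isColimit_exists_of_rep_eq _ (isColimitCocone I i M) x y hxy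
  rw [Subsingleton.elim g f] at hfg
  exact h _ _ _ hfg

end localCohomology

end LocalCohomology

theorem grade_eq_filter_depth_of_grade_lt_depth
    {R : Type u} [CommRing R] [IsNoetherianRing R] [IsLocalRing R]
    (𝔞 : Ideal R) (M : Type u) [AddCommGroup M] [Module R M] [Module.Finite R M] [Nontrivial M]
    (h_proper : (𝔞 • ⊤ : Submodule R M) ≠ ⊤) (r : ℕ)
    (h_grade_mem : Nontrivial
      (((Ext R (ModuleCat.{u} R) r).obj (op (ModuleCat.of R (R ⧸ 𝔞)))).obj (ModuleCat.of R M)))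
    (h_grade_min : ∀ i < r, Subsingleton
      (((Ext R (ModuleCat.{u} R) i).obj (op (ModuleCat.of R (R ⧸ 𝔞)))).obj (ModuleCat.of R M)))
    (h_lt_depth : ∀ i ≤ r, Subsingleton
      (((Ext R (ModuleCat.{u} R) i).obj
        (op (ModuleCat.of R (R ⧸ IsLocalRing.maximalIdeal R)))).obj (ModuleCat.of R M))) :
    (∀ i < r, IsArtinian R ((localCohomology 𝔞 i).obj (ModuleCat.of R M))) ∧
      ¬ IsArtinian R ((localCohomology 𝔞 r).obj (ModuleCat.of R M)) := by
  have h_lt : (𝔞 • ⊤ : Submodule R (ModuleCat.of R M)) < ⊤ := Ne.lt_top h_proper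
  obtain ⟨rs, rfl, hmem, hreg⟩ := ModuleCat.exists_isRegular_of_exists_subsingleton_ext 𝔞 r
    (ModuleCat.of R M) h_lt (ModuleCat.of R (R ⧸ 𝔞))
    (by rw [Module.support_eq_zeroLocus, Ideal.annihilator_quotient])
    fun i hi ↦ subsingleton_ext_obj_iff.mp (h_grade_min i hi)
  have hvan (N : Type u) [AddCommGroup N] [Module R N] [Module.Finite R N]
      (hN : Module.support R N ⊆ PrimeSpectrum.zeroLocus 𝔞) :
      ∀ i < rs.length, Subsingleton (Abelian.Ext (ModuleCat.of R N) (ModuleCat.of R M) i) :=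
    ModuleCat.subsingleton_ext_of_exists_isRegular 𝔞 (ModuleCat.of R N) hN _ h_lt rs hmem hreg
  refine ⟨fun i hi ↦ ?_, fun hart ↦ ?_⟩
  · have := localCohomology.subsingleton_of_forall (I := 𝔞) (i := i) (M := ModuleCat.of R M)
      fun n ↦ subsingleton_ext_obj_iff.mpr (hvan _ (𝔞.support_quotient_pow_subset n) i hi)
    infer_instance
  · have hinj := localCohomology.injective_ι_app (I := 𝔞) (i := rs.length) (M := ModuleCat.of R M)
      (fun m n hmn ↦ injective_ext_map_app fun x hx ↦
        (LinearMap.shortExact_shortComplexKer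
          (f := Submodule.mapQ _ _ LinearMap.id hmn)
          (Submodule.factor_surjective hmn)).injective_precomp_mk₀_g
          (hvan _ ((Module.support_subset_of_injective _ (Submodule.injective_subtype _)).trans
            (𝔞.support_quotient_pow_subset m))) x hx)
      (op (op 1))
    let E := ((Ext R (ModuleCat.{u} R) rs.length).obj (op (ModuleCat.of R (R ⧸ 𝔞 ^ 1)))).obj
      (ModuleCat.of R M)
    have hE : Nontrivial E := by
      dsimp only [E]
      rwa [pow_one]
    let ι : E ⟶ (localCohomology 𝔞 rs.length).obj (ModuleCat.of R M) :=
      (localCohomology.cocone 𝔞 rs.length (ModuleCat.of R M)).ι.app (op (op 1))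
    have : IsArtinian R E := isArtinian_of_injective ι.hom hinj
    obtain ⟨e, he, hme⟩ := IsLocalRing.exists_ne_zero_forall_smul_eq_zero (R := R) E
    refine he (ext_obj_eq_zero_of_smul_eq_zero (fun x hx ↦ ?_) e hme)
    exact hreg.toIsWeaklyRegular.ext_eq_zero_of_smul_eq_zero
      (by simpa [Ideal.annihilator_quotient] using hmem)
      (hvan _ (𝔞.support_quotient_pow_subset 1))
      (fun i hi ↦ subsingleton_ext_obj_iff.mp (h_lt_depth i hi)) x hx
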